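/- arXiv:1710.09936 — 2 statements merged into one kernel-verified Lean document; each statement's English description precedes it below -/
import Mathlib

section
/- Let I ⊆ (0,∞) be an interval and let f : I → (0,∞) satisfy f(x^t · y^{1−t}) ≥ f(x)·f(y) / ((1−t)·f(x) + t·f(y)) for all x,y ∈ I and t ∈ [0,1]. Then for all x, y, z ∈ I: (2/3)·(1/f(√(xz)) + 1/f(√(yz)) + 1/f(√(xy))) ≤ (1/3)·(1/f(x) + 1/f(y) + 1/f(z)) + 1/f((xyz)^{1/3}). -/
/-- Popoviciu's inequality when `a` and `b` lie on the same side of the mean of `a, b, c`. -/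
theorem ConvexOn.popoviciu_of_same_side {s : Set ℝ} {g : ℝ → ℝ} (hg : ConvexOn ℝ s g)
    {a b c : ℝ} (ha : a ∈ s) (hb : b ∈ s) (hc : c ∈ s)
    (hab : 0 ≤ (a - (a + b + c) / 3) * (b - (a + b + c) / 3)) :
    2 * (g ((a + b) / 2) + g ((b + c) / 2) + g ((a + c) / 2)) ≤
      g a + g b + g c + 3 * g ((a + b + c) / 3) := by
  have hm : (a + b + c) / 3 ∈ s := by
    have h := hg.1.sum_mem (t := Finset.univ) (w := fun _ : Fin 3 => (1 / 3 : ℝ))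
      (z := ![a, b, c]) (by intros; norm_num) (by norm_num)
      (by intro i _; fin_cases i <;> assumption)
    convert h using 1
    simp [Fin.sum_univ_three]
    ring
  have hmid : g ((a + b) / 2) ≤ (g a + g b) / 2 := by
    have h := hg.2 ha hb (by norm_num : (0 : ℝ) ≤ 1 / 2) (by norm_num : (0 : ℝ) ≤ 1 / 2)
      (by norm_num)
    simp only [smul_eq_mul] at h
    rw [show 1 / 2 * a + 1 / 2 * b = (a + b) / 2 by ring] at h
    linarith
  obtain ⟨m, hm_eq⟩ : ∃ m, m = (a + b + c) / 3 := ⟨_, rfl⟩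
  rw [← hm_eq] at hm hab ⊢
  obtain ⟨u, hu0, hu1, hu⟩ : ∃ u : ℝ, 0 ≤ u ∧ u ≤ 1 / 2 ∧ b - m = 2 * u * (m - c) := by
    have hsum : m - c = (a - m) + (b - m) := by linarith
    by_cases h0 : m - c = 0
    · refine ⟨0, le_rfl, by norm_num, ?_⟩
      have : b - m = 0 := by nlinarith
      linarith
    · have hpos : 0 < (m - c) ^ 2 := by positivity
      refine ⟨(b - m) * (m - c) / (2 * (m - c) ^ 2), ?_, ?_, ?_⟩
      · apply div_nonneg _ (by positivity)
        rw [hsum]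
        nlinarith [sq_nonneg (b - m)]
      · rw [div_le_iff₀ (by positivity), hsum]
        nlinarith [sq_nonneg (a - m)]
      · field_simp
  have hac : g ((a + c) / 2) ≤ u * g c + (1 - u) * g m := by
    have h := hg.2 hc hm hu0 (by linarith : 0 ≤ 1 - u) (by ring)
    simp only [smul_eq_mul] at h
    rwa [show u * c + (1 - u) * m = (a + c) / 2 by linarith] at h
  have hbc : g ((b + c) / 2) ≤ (1 / 2 - u) * g c + (1 / 2 + u) * g m := by
    have h := hg.2 hc hm (by linarith : 0 ≤ 1 / 2 - u) (by linarith : 0 ≤ 1 / 2 + u) (by ring)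
    simp only [smul_eq_mul] at h
    rwa [show (1 / 2 - u) * c + (1 / 2 + u) * m = (b + c) / 2 by linarith] at h
  linarith

/-- **Popoviciu's inequality** for convex functions on a convex set of reals. -/
theorem ConvexOn.popoviciu {s : Set ℝ} {g : ℝ → ℝ} (hg : ConvexOn ℝ s g)
    {a b c : ℝ} (ha : a ∈ s) (hb : b ∈ s) (hc : c ∈ s) :
    2 * (g ((a + b) / 2) + g ((b + c) / 2) + g ((a + c) / 2)) ≤
      g a + g b + g c + 3 * g ((a + b + c) / 3) := by
  rcases le_or_gt 0 ((a - (a + b + c) / 3) * (b - (a + b + c) / 3)) with hab | hab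
  · exact hg.popoviciu_of_same_side ha hb hc hab
  rcases le_or_gt 0 ((b - (a + b + c) / 3) * (c - (a + b + c) / 3)) with hbc | hbc
  · have h := hg.popoviciu_of_same_side hb hc ha
      (by rwa [show b + c + a = a + b + c by ring])
    rw [show b + c + a = a + b + c by ring, add_comm c a, add_comm b a] at h
    linarith
  · have h := hg.popoviciu_of_same_side ha hc hb (by
      rw [show a + c + b = a + b + c by ring]
      by_contra! hac
      nlinarith [mul_pos_of_neg_of_neg hab hbc, sq_nonneg (b - (a + b + c) / 3)])
    rw [show a + c + b = a + b + c by ring, add_comm c b] at h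
    linarith

/-- A `G_tH_t`-concave function has convex reciprocal in logarithmic coordinates. -/
theorem convexOn_inv_comp_exp_of_GH_concave {I : Set ℝ} (hI : Convex ℝ I) {f : ℝ → ℝ}
    (hf_pos : ∀ x ∈ I, 0 < f x)
    (hf : ∀ x ∈ I, ∀ y ∈ I, ∀ t ∈ Set.Icc (0 : ℝ) 1,
      f (x ^ t * y ^ (1 - t)) ≥ f x * f y / ((1 - t) * f x + t * f y)) :
    ConvexOn ℝ (Real.exp ⁻¹' I) (fun u => 1 / f (Real.exp u)) := by
  refine ⟨(hI.ordConnected.preimage_mono Real.exp_monotone).convex, ?_⟩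
  intro u hu v hv p q hp hq hpq
  obtain rfl : q = 1 - p := by linarith
  have h := hf _ hu _ hv p ⟨hp, by linarith⟩
  rw [← Real.exp_mul, ← Real.exp_mul, ← Real.exp_add, mul_comm u, mul_comm v] at h
  have hfu := hf_pos _ hu
  have hfv := hf_pos _ hv
  have hden : 0 < (1 - p) * f (Real.exp u) + p * f (Real.exp v) := by
    rcases hp.eq_or_lt with rfl | hp
    · simpa using hfu
    · nlinarith [mul_pos hp hfv, mul_nonneg hq hfu.le]
  simp only [smul_eq_mul]
  calc 1 / f (Real.exp (p * u + (1 - p) * v))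
      ≤ 1 / (f (Real.exp u) * f (Real.exp v) /
          ((1 - p) * f (Real.exp u) + p * f (Real.exp v))) :=
        one_div_le_one_div_of_le (by positivity) h
    _ = p * (1 / f (Real.exp u)) + (1 - p) * (1 / f (Real.exp v)) := by
        field_simp
        ring

/-- Popoviciu-type inequality for `G_tH_t`-concave functions. -/
theorem popoviciu_GH (I : Set ℝ) (hI : Convex ℝ I) (hI_pos : I ⊆ Set.Ioi (0 : ℝ))
    (f : ℝ → ℝ) (hf_pos : ∀ x ∈ I, 0 < f x)
    (hf : ∀ x ∈ I, ∀ y ∈ I, ∀ t ∈ Set.Icc (0 : ℝ) 1,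
      f (x ^ t * y ^ (1 - t)) ≥ f x * f y / ((1 - t) * f x + t * f y)) :
    ∀ x ∈ I, ∀ y ∈ I, ∀ z ∈ I,
      (2 / 3) * (1 / f (Real.sqrt (x * z)) + 1 / f (Real.sqrt (y * z)) +
          1 / f (Real.sqrt (x * y))) ≤
        (1 / 3) * (1 / f x + 1 / f y + 1 / f z) +
          1 / f ((x * y * z) ^ ((1 : ℝ) / 3)) := by
  intro x hx y hy z hz
  have hx0 : 0 < x := hI_pos hx
  have hy0 : 0 < y := hI_pos hy
  have hz0 : 0 < z := hI_pos hz
  have sqrt_eq {a b : ℝ} (ha : 0 < a) (hb : 0 < b) :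
      Real.exp ((Real.log a + Real.log b) / 2) = Real.sqrt (a * b) := by
    rw [Real.exp_half, Real.exp_add, Real.exp_log ha, Real.exp_log hb]
  have cbrt_eq : Real.exp ((Real.log x + Real.log y + Real.log z) / 3) =
      (x * y * z) ^ ((1 : ℝ) / 3) := by
    rw [Real.rpow_def_of_pos (by positivity), Real.log_mul (by positivity) hz0.ne',
      Real.log_mul hx0.ne' hy0.ne']
    ring_nf
  have mem {a : ℝ} (ha : a ∈ I) : Real.log a ∈ Real.exp ⁻¹' I := by
    rwa [Set.mem_preimage, Real.exp_log (hI_pos ha)]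
  have h := (convexOn_inv_comp_exp_of_GH_concave hI hf_pos hf).popoviciu (mem hx) (mem hy) (mem hz)
  simp only [sqrt_eq hx0 hy0, sqrt_eq hy0 hz0, sqrt_eq hx0 hz0, cbrt_eq,
    Real.exp_log hx0, Real.exp_log hy0, Real.exp_log hz0] at h
  linarith
end

section
/- Let I ⊆ (0,∞) be an interval and let f : I → (0,∞) satisfy f(x·y / (t·x + (1−t)·y)) ≤ f(x)^{1−t} · f(y)^{t} for all x,y ∈ I and t ∈ [0,1]. Then for all x, y, z ∈ I: f(2xz/(x+z)) · f(2yz/(y+z)) · f(2xy/(x+y)) ≤ f(3xyz/(xy + yz + xz))^{3/2} · (f(x)·f(y)·f(z))^{1/2}. -/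
theorem ConvexOn.add_le_of_mem_segment {J : Set ℝ} {g : ℝ → ℝ} (hg : ConvexOn ℝ J g)
    {m z a b : ℝ} (hm : m ∈ J) (hz : z ∈ J) (ha : a ∈ segment ℝ m z) (hb : b ∈ segment ℝ m z)
    (hab : 2 * (a + b) = 3 * m + z) : 2 * (g a + g b) ≤ 3 * g m + g z := by
  rcases eq_or_ne m z with rfl | hne
  · rw [segment_same] at ha hb
    rw [Set.mem_singleton_iff] at ha hb
    subst ha hb
    linarith
  · obtain ⟨p, q, hp, hq, hpq, rfl⟩ := ha
    obtain ⟨p', q', hp', hq', hpq', rfl⟩ := hb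
    have h₁ := hg.2 hm hz hp hq hpq
    have h₂ := hg.2 hm hz hp' hq' hpq'
    simp only [smul_eq_mul] at *
    obtain rfl : p = 1 - q := by linarith
    obtain rfl : p' = 1 - q' := by linarith
    have hqq : q' = 1 / 2 - q := by
      have : (z - m) * (q' - (1 / 2 - q)) = 0 := by linear_combination hab / 2
      rcases mul_eq_zero.1 this with h | h
      · exact absurd (by linarith) hne
      · linarith
    subst hqq
    linarith

/-- Popoviciu's inequality for ordered points. -/
theorem ConvexOn.popoviciu_of_le {J : Set ℝ} {g : ℝ → ℝ} (hg : ConvexOn ℝ J g)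
    {x y z : ℝ} (hx : x ∈ J) (hy : y ∈ J) (hz : z ∈ J) (hxy : x ≤ y) (hyz : y ≤ z) :
    2 * (g ((x + y) / 2) + g ((y + z) / 2) + g ((x + z) / 2)) ≤
      3 * g ((x + y + z) / 3) + (g x + g y + g z) := by
  have midpoint_le {u v : ℝ} (hu : u ∈ J) (hv : v ∈ J) : 2 * g ((u + v) / 2) ≤ g u + g v := by
    have h := hg.2 hu hv
      (by norm_num : (0 : ℝ) ≤ 1 / 2) (by norm_num : (0 : ℝ) ≤ 1 / 2) (by norm_num)
    simp only [smul_eq_mul] at h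
    rw [show 1 / 2 * u + 1 / 2 * v = (u + v) / 2 by ring] at h
    linarith
  have hm : (x + y + z) / 3 ∈ J :=
    hg.1.ordConnected.out hx hz ⟨by linarith, by linarith⟩
  rcases le_total y ((x + y + z) / 3) with h | h
  · have h₁ := midpoint_le hx hy
    have h₂ := hg.add_le_of_mem_segment hm hz (a := (y + z) / 2) (b := (x + z) / 2)
      (Icc_subset_segment ⟨by linarith, by linarith⟩)
      (Icc_subset_segment ⟨by linarith, by linarith⟩) (by ring)
    linarith
  · have h₁ := midpoint_le hy hz
    have h₂ := hg.add_le_of_mem_segment hm hx (a := (x + y) / 2) (b := (x + z) / 2)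
      (segment_symm ℝ x _ ▸ Icc_subset_segment ⟨by linarith, by linarith⟩)
      (segment_symm ℝ x _ ▸ Icc_subset_segment ⟨by linarith, by linarith⟩) (by ring)
    linarith

/-- **Popoviciu's inequality** for convex functions. -/
theorem ConvexOn.popoviciu_s16 {J : Set ℝ} {g : ℝ → ℝ} (hg : ConvexOn ℝ J g)
    {x y z : ℝ} (hx : x ∈ J) (hy : y ∈ J) (hz : z ∈ J) :
    2 * (g ((x + y) / 2) + g ((y + z) / 2) + g ((x + z) / 2)) ≤
      3 * g ((x + y + z) / 3) + (g x + g y + g z) := by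
  wlog hxy : x ≤ y generalizing x y
  · have h := this hy hx (le_of_not_ge hxy)
    rw [add_comm y x] at h
    linarith
  rcases le_total y z with hyz | hzy
  · exact hg.popoviciu_of_le hx hy hz hxy hyz
  rcases le_total x z with hxz | hzx
  · have h := hg.popoviciu_of_le hx hz hy hxz hzy
    rw [add_comm z y, add_right_comm x z y] at h
    linarith
  · have h := hg.popoviciu_of_le hz hx hy hzx hxy
    rw [add_comm z y, add_comm z x, add_right_comm x z y] at h
    linarith

theorem convexOn_log_comp_inv {I : Set ℝ} (hI : Convex ℝ I) (hI_pos : I ⊆ Set.Ioi (0 : ℝ))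
    {f : ℝ → ℝ} (hf_pos : ∀ x ∈ I, 0 < f x)
    (hf : ∀ x ∈ I, ∀ y ∈ I, ∀ t ∈ Set.Icc (0 : ℝ) 1,
      f (x * y / (t * x + (1 - t) * y)) ≤ f x ^ (1 - t) * f y ^ t) :
    ConvexOn ℝ {u : ℝ | u⁻¹ ∈ I} fun u => Real.log (f u⁻¹) := by
  have hJ : Convex ℝ {u : ℝ | u⁻¹ ∈ I} := by
    refine Set.OrdConnected.convex ⟨fun u hu v hv w hw => ?_⟩
    have hu₀ : 0 < u := inv_pos.1 (hI_pos hu)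
    exact hI.ordConnected.out hv hu
      ⟨inv_anti₀ (hu₀.trans_le hw.1) hw.2, inv_anti₀ hu₀ hw.1⟩
  refine ⟨hJ, fun u hu v hv a b ha hb hab => ?_⟩
  have hw := hJ hu hv ha hb hab
  have hu₀ : 0 < u := inv_pos.1 (hI_pos hu)
  have hv₀ : 0 < v := inv_pos.1 (hI_pos hv)
  have h := hf _ hu _ hv b ⟨hb, by linarith⟩
  obtain rfl : a = 1 - b := by linarith
  simp only [smul_eq_mul] at *
  have hfw := hf_pos _ hw
  have heq : u⁻¹ * v⁻¹ / (b * u⁻¹ + (1 - b) * v⁻¹) = ((1 - b) * u + b * v)⁻¹ := by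
    have : b * u⁻¹ + (1 - b) * v⁻¹ = ((1 - b) * u + b * v) * (u⁻¹ * v⁻¹) := by
      field_simp
      ring
    rw [this]
    field_simp
  rw [heq] at h
  have hfu := hf_pos _ hu
  have hfv := hf_pos _ hv
  have hlog := Real.log_le_log hfw h
  rwa [Real.log_mul (Real.rpow_pos_of_pos hfu _).ne' (Real.rpow_pos_of_pos hfv _).ne',
    Real.log_rpow hfu, Real.log_rpow hfv] at hlog

/-- Popoviciu-type inequality for `H_tG_t`-convex functions. -/
theorem popoviciu_HG (I : Set ℝ) (hI : Convex ℝ I) (hI_pos : I ⊆ Set.Ioi (0 : ℝ))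
    (f : ℝ → ℝ) (hf_pos : ∀ x ∈ I, 0 < f x)
    (hf : ∀ x ∈ I, ∀ y ∈ I, ∀ t ∈ Set.Icc (0 : ℝ) 1,
      f (x * y / (t * x + (1 - t) * y)) ≤ f x ^ (1 - t) * f y ^ t) :
    ∀ x ∈ I, ∀ y ∈ I, ∀ z ∈ I,
      f (2 * x * z / (x + z)) * f (2 * y * z / (y + z)) * f (2 * x * y / (x + y)) ≤
        f (3 * x * y * z / (x * y + y * z + x * z)) ^ ((3 : ℝ) / 2) *
          (f x * f y * f z) ^ ((1 : ℝ) / 2) := by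
  intro x hx y hy z hz
  have hx₀ : 0 < x := hI_pos hx
  have hy₀ : 0 < y := hI_pos hy
  have hz₀ : 0 < z := hI_pos hz
  have hg := convexOn_log_comp_inv hI hI_pos hf_pos hf
  have inv_mem {u : ℝ} (hu : u ∈ I) : u⁻¹ ∈ {u : ℝ | u⁻¹ ∈ I} := by simpa using hu
  have harmonic_mem {u v : ℝ} (hu : u ∈ I) (hv : v ∈ I) : ((u⁻¹ + v⁻¹) / 2)⁻¹ ∈ I := by
    have h := hg.1 (inv_mem hu) (inv_mem hv)
      (by norm_num : (0 : ℝ) ≤ 1 / 2) (by norm_num : (0 : ℝ) ≤ 1 / 2) (by norm_num)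
    simp only [smul_eq_mul] at h
    rwa [show 1 / 2 * u⁻¹ + 1 / 2 * v⁻¹ = (u⁻¹ + v⁻¹) / 2 by ring] at h
  have hm : ((x⁻¹ + y⁻¹ + z⁻¹) / 3)⁻¹ ∈ I := by
    have h := hg.1 (inv_mem (harmonic_mem hx hy)) (inv_mem hz)
      (by norm_num : (0 : ℝ) ≤ 2 / 3) (by norm_num : (0 : ℝ) ≤ 1 / 3) (by norm_num)
    simp only [smul_eq_mul, inv_inv] at h
    rwa [show 2 / 3 * ((x⁻¹ + y⁻¹) / 2) + 1 / 3 * z⁻¹ = (x⁻¹ + y⁻¹ + z⁻¹) / 3 by ring] at h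
  have h := hg.popoviciu_s16 (inv_mem hx) (inv_mem hy) (inv_mem hz)
  rw [show 2 * x * z / (x + z) = ((x⁻¹ + z⁻¹) / 2)⁻¹ by field_simp; ring,
    show 2 * y * z / (y + z) = ((y⁻¹ + z⁻¹) / 2)⁻¹ by field_simp; ring,
    show 2 * x * y / (x + y) = ((x⁻¹ + y⁻¹) / 2)⁻¹ by field_simp; ring,
    show 3 * x * y * z / (x * y + y * z + x * z) = ((x⁻¹ + y⁻¹ + z⁻¹) / 3)⁻¹ by
      field_simp; ring]
  have hfxz := hf_pos _ (harmonic_mem hx hz)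
  have hfyz := hf_pos _ (harmonic_mem hy hz)
  have hfxy := hf_pos _ (harmonic_mem hx hy)
  have hfm := hf_pos _ hm
  have hfx := hf_pos _ hx
  have hfy := hf_pos _ hy
  have hfz := hf_pos _ hz
  simp only [inv_inv x, inv_inv y, inv_inv z] at h
  rw [← Real.log_le_log_iff (by positivity) (by positivity),
    Real.log_mul (by positivity) (by positivity), Real.log_mul (by positivity) (by positivity),
    Real.log_mul (by positivity) (by positivity), Real.log_rpow (by positivity),
    Real.log_rpow (by positivity), Real.log_mul (by positivity) (by positivity),
    Real.log_mul (by positivity) (by positivity)]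
  linarith
end
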